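/- Let η_ε be the standard mollifier on ℝⁿ. For f ∈ W^{1,∞}(Ω) and g ∈ L²(Ω) with compact support in Ω, there is a constant C independent of ε such that ‖∇(η_ε ∗ (fg) − f (η_ε ∗ g))‖_{L²(Ω)} ≤ C ‖f‖_{W^{1,∞}(Ω)} ‖g‖_{L²(Ω)} whenever 0 < ε < min{dist(∂Ω, spt f), dist(∂Ω, spt g)}. -/

import Mathlib

open MeasureTheory

/-- Partial derivative `∂f/∂xᵢ` of a scalar function on `ℝⁿ`. -/
noncomputable def pdn {n : ℕ} (f : (Fin n → ℝ) → ℝ) (i : Fin n) (x : Fin n → ℝ) : ℝ :=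
  fderiv ℝ f x (Pi.single i 1)

/-- The standard bump `η(x) = c · exp(1/(|x|²−1))` for `|x| < 1`, `0` otherwise. -/
noncomputable def stdBump (n : ℕ) (c : ℝ) (x : Fin n → ℝ) : ℝ :=
  if ∑ i, x i ^ 2 < 1 then c * Real.exp (1 / (∑ i, x i ^ 2 - 1)) else 0

/-- The standard mollifier `η_ε(x) = ε^{-n} η(x/ε)`. -/
noncomputable def stdMollifier (n : ℕ) (c ε : ℝ) (x : Fin n → ℝ) : ℝ :=
  ε ^ (-(n : ℤ)) * stdBump n c (ε⁻¹ • x)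

/-- Convolution `(η_ε ∗ g)(x) = ∫ η_ε(x−y) g(y) dy`. -/
noncomputable def mollify (n : ℕ) (c ε : ℝ) (g : (Fin n → ℝ) → ℝ) (x : Fin n → ℝ) : ℝ :=
  ∫ y : Fin n → ℝ, stdMollifier n c ε (x - y) * g y

section CommutatorEstimate

set_option linter.unusedSectionVars false

open Metric Set Filter Topology Pointwise

/-- A `C¹` kernel on `E` whose nonvanishing set is convex and contained in the closed ball of
radius `ε`, with explicit bounds on the kernel and on its derivative. -/
structure IsConvexKernel {E : Type*} [NormedAddCommGroup E] [NormedSpace ℝ E]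
    (ρ : E → ℝ) (ε K₀ K₁ : ℝ) : Prop where
  contDiff : ContDiff ℝ 1 ρ
  convex : Convex ℝ {x | ρ x ≠ 0}
  dist_le : ∀ x, ρ x ≠ 0 → ‖x‖ ≤ ε
  bound : ∀ x, |ρ x| ≤ K₀
  fderiv_bound : ∀ x, ‖fderiv ℝ ρ x‖ ≤ K₁

/-- The points at which the convolution integral of `ρ` and `φ` converges absolutely. -/
def convPoints {E : Type*} [NormedAddCommGroup E] [MeasurableSpace E] (μ : Measure E)
    (ρ φ : E → ℝ) : Set E :=
  {z | Integrable (fun y => ρ (z - y) * φ y) μ}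

/-- The region seen by the kernel `ρ` from the points of `convPoints μ ρ φ`. -/
def convRegion {E : Type*} [NormedAddCommGroup E] [MeasurableSpace E] (μ : Measure E)
    (ρ φ : E → ℝ) : Set E :=
  ⋃ z ∈ convPoints μ ρ φ, {y | ρ (z - y) ≠ 0}

lemma mul_indicator_convRegion {E : Type*} [NormedAddCommGroup E] [MeasurableSpace E]
    {μ : Measure E} {ρ φ : E → ℝ} {z : E}
    (hz : z ∈ convPoints μ ρ φ) (y : E) :
    ρ (z - y) * (convRegion μ ρ φ).indicator φ y = ρ (z - y) * φ y := by
  by_cases h : ρ (z - y) = 0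
  · simp [h]
  · have hy : y ∈ convRegion μ ρ φ := mem_biUnion hz (show y ∈ {y | ρ (z - y) ≠ 0} from h)
    rw [indicator_of_mem hy]

lemma fderiv_eq_of_eqOn_convex {E : Type*} [NormedAddCommGroup E] [NormedSpace ℝ E]
    {h k : E → ℝ} {B : Set E} {x : E} (hB : Convex ℝ B) (hBo : IsOpen B)
    (hx : x ∈ closure B) (heq : EqOn h k B) (hh : DifferentiableAt ℝ h x)
    (hk : DifferentiableAt ℝ k x) : fderiv ℝ h x = fderiv ℝ k x := by
  have hne : (interior B).Nonempty := by
    rw [hBo.interior_eq]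
    exact closure_nonempty_iff.1 ⟨x, hx⟩
  have hxB : (𝓝[B] x).NeBot := mem_closure_iff_nhdsWithin_neBot.1 hx
  have hval : h x = k x := by
    have hkt : Tendsto h (𝓝[B] x) (𝓝 (k x)) :=
      hk.continuousAt.continuousWithinAt.tendsto.congr'
        (eventually_mem_nhdsWithin.mono fun z hz => (heq hz).symm)
    exact tendsto_nhds_unique hh.continuousAt.continuousWithinAt.tendsto hkt
  exact (uniqueDiffWithinAt_convex hB hne hx).eq hh.hasFDerivAt.hasFDerivWithinAt
    (hk.hasFDerivAt.hasFDerivWithinAt.congr heq hval)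

section Kernel

variable {E : Type*} [NormedAddCommGroup E] [NormedSpace ℝ E] [FiniteDimensional ℝ E]
  [MeasurableSpace E] [BorelSpace E] {μ : Measure E} [μ.IsAddHaarMeasure]
  {ρ φ γ : E → ℝ} {ε K₀ K₁ : ℝ}

namespace IsConvexKernel

lemma continuous (hρ : IsConvexKernel ρ ε K₀ K₁) : Continuous ρ := hρ.contDiff.continuous

lemma hasCompactSupport (hρ : IsConvexKernel ρ ε K₀ K₁) : HasCompactSupport ρ :=
  HasCompactSupport.intro (isCompact_closedBall (0 : E) ε) fun x hx => by
    by_contra h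
    exact hx (by simpa using hρ.dist_le x h)

lemma isOpen_ne (hρ : IsConvexKernel ρ ε K₀ K₁) (z : E) : IsOpen {y | ρ (z - y) ≠ 0} :=
  isOpen_ne_fun (hρ.continuous.comp (by fun_prop)) continuous_const

lemma integrable_mul (hρ : IsConvexKernel ρ ε K₀ K₁) (hφ : LocallyIntegrable φ μ) (z : E) :
    Integrable (fun y => ρ (z - y) * φ y) μ := by
  refine hφ.integrable_smul_left_of_hasCompactSupport (g := fun y => ρ (z - y))
    (hρ.continuous.comp (by fun_prop)) ?_
  exact hρ.hasCompactSupport.comp_homeomorph (Homeomorph.subLeft z)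

lemma isOpen_convRegion (hρ : IsConvexKernel ρ ε K₀ K₁) : IsOpen (convRegion μ ρ φ) :=
  isOpen_biUnion fun z _ => hρ.isOpen_ne z

lemma aestronglyMeasurable_restrict (hρ : IsConvexKernel ρ ε K₀ K₁) {z : E}
    (hz : z ∈ convPoints μ ρ φ) :
    AEStronglyMeasurable φ (μ.restrict {y | ρ (z - y) ≠ 0}) := by
  have h1 : Measurable fun y => (ρ (z - y))⁻¹ :=
    (hρ.continuous.comp (by fun_prop : Continuous fun y => z - y)).measurable.inv
  refine (h1.aestronglyMeasurable.mul hz.aestronglyMeasurable.restrict).congr ?_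
  filter_upwards [ae_restrict_mem (hρ.isOpen_ne z).measurableSet] with y hy
  exact inv_mul_cancel_left₀ hy _

lemma aestronglyMeasurable_indicator (hρ : IsConvexKernel ρ ε K₀ K₁) :
    AEStronglyMeasurable ((convRegion μ ρ φ).indicator φ) μ := by
  rw [aestronglyMeasurable_indicator_iff hρ.isOpen_convRegion.measurableSet]
  obtain ⟨T, hT, hTc, hU⟩ := TopologicalSpace.isOpen_biUnion_countable (convPoints μ ρ φ)
    (fun z => {y | ρ (z - y) ≠ 0}) fun z _ => hρ.isOpen_ne z
  rw [convRegion, ← hU, biUnion_eq_iUnion]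
  have := hTc.to_subtype
  exact aestronglyMeasurable_iUnion_iff.2 fun z =>
    hρ.aestronglyMeasurable_restrict (hT z.2)

lemma mem_convPoints (hρ : IsConvexKernel ρ ε K₀ K₁) (hγ : LocallyIntegrable γ μ)
    (hle : ∀ y, |φ y| ≤ γ y) {z : E}
    (hm : AEStronglyMeasurable φ (μ.restrict {y | ρ (z - y) ≠ 0})) :
    z ∈ convPoints μ ρ φ := by
  have hs := (hρ.isOpen_ne z).measurableSet
  have hi : LocallyIntegrable ({y | ρ (z - y) ≠ 0}.indicator φ) μ := by
    refine hγ.mono ((aestronglyMeasurable_indicator_iff hs).2 hm) (ae_of_all _ fun y => ?_)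
    exact (norm_indicator_le_norm_self _ _).trans ((hle y).trans (le_abs_self _))
  refine (hρ.integrable_mul hi z).congr (ae_of_all _ fun y => ?_)
  by_cases h : ρ (z - y) = 0
  · simp [h]
  · simp [h]

lemma exists_notMem_convRegion (hρ : IsConvexKernel ρ ε K₀ K₁) (hγ : LocallyIntegrable γ μ)
    (hle : ∀ y, |φ y| ≤ γ y) {z : E} (hz : z ∉ convPoints μ ρ φ) :
    ∃ y ∉ convRegion μ ρ φ, ρ (z - y) ≠ 0 := by
  by_contra! h
  refine hz (hρ.mem_convPoints hγ hle ?_)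
  have h1 := (aestronglyMeasurable_indicator_iff hρ.isOpen_convRegion.measurableSet).1
    (hρ.aestronglyMeasurable_indicator (μ := μ) (φ := φ))
  exact h1.mono_set fun y hy => by_contra fun hn => hy (h y hn)

/-- Every point of the closure of the divergence set is touched by an open convex set of
divergence. -/
lemma exists_convex_of_mem_closure (hρ : IsConvexKernel ρ ε K₀ K₁) (hγ : LocallyIntegrable γ μ)
    (hle : ∀ y, |φ y| ≤ γ y) {x : E} (hx : x ∈ closure (convPoints μ ρ φ)ᶜ) :
    ∃ B : Set E, Convex ℝ B ∧ IsOpen B ∧ x ∈ closure B ∧ B ⊆ (convPoints μ ρ φ)ᶜ := by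
  have hclosed : IsClosed ((convRegion μ ρ φ)ᶜ + closure {x | ρ x ≠ 0}) :=
    (hρ.isOpen_convRegion.isClosed_compl).add_right_of_isCompact hρ.hasCompactSupport
  have hsub : (convPoints μ ρ φ)ᶜ ⊆ (convRegion μ ρ φ)ᶜ + closure {x | ρ x ≠ 0} := by
    intro z hz
    obtain ⟨y, hy, hne⟩ := hρ.exists_notMem_convRegion hγ hle hz
    exact ⟨y, hy, z - y, subset_closure hne, by simp⟩
  obtain ⟨y, hy, s, hs, rfl⟩ := closure_minimal hsub hclosed hx
  have himg : {z | ρ (z - y) ≠ 0} = Homeomorph.addLeft y '' {x | ρ x ≠ 0} := by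
    ext z
    simp only [Homeomorph.coe_addLeft, mem_image, mem_ofPred_eq]
    exact ⟨fun h => ⟨z - y, h, by simp⟩, by rintro ⟨w, hw, rfl⟩; simpa using hw⟩
  refine ⟨{z | ρ (z - y) ≠ 0}, ?_, ?_, ?_, fun z hz hzP => hy (mem_biUnion hzP hz)⟩
  · rw [himg]
    simpa [← image_vadd] using hρ.convex.vadd y
  · exact isOpen_ne_fun (hρ.continuous.comp (by fun_prop)) continuous_const
  · rw [himg, ← Homeomorph.image_closure]
    exact ⟨s, hs, rfl⟩

/-- Differentiability of the convolution with a locally integrable function, with a bound on the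
derivative in terms of the local mass of a majorant. -/
lemma differentiableAt_and_norm_fderiv_le (hρ : IsConvexKernel ρ ε K₀ K₁)
    (hφ : LocallyIntegrable φ μ) (hγ : LocallyIntegrable γ μ) {A : ℝ} (x : E)
    (hle : ∀ y ∈ closedBall x ε, |φ y| ≤ A * γ y) :
    DifferentiableAt ℝ (fun z => ∫ y, ρ (z - y) * φ y ∂μ) x ∧
      ‖fderiv ℝ (fun z => ∫ y, ρ (z - y) * φ y ∂μ) x‖ ≤
        K₁ * A * ∫ y in closedBall x ε, γ y ∂μ := by
  have hD := hρ.hasCompactSupport.hasFDerivAt_convolution_left (ContinuousLinearMap.mul ℝ ℝ)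
    hρ.contDiff hφ x
  have heq : (convolution ρ φ (ContinuousLinearMap.mul ℝ ℝ) μ) =
      fun z => ∫ y, ρ (z - y) * φ y ∂μ := funext fun z => convolution_mul_swap
  rw [heq] at hD
  refine ⟨hD.differentiableAt, ?_⟩
  rw [hD.fderiv, convolution_eq_swap, ← integral_const_mul,
    ← integral_indicator measurableSet_closedBall]
  have hK₁ : 0 ≤ K₁ := (norm_nonneg _).trans (hρ.fderiv_bound 0)
  refine norm_integral_le_of_norm_le ?_ (ae_of_all _ fun y => ?_)
  · rw [integrable_indicator_iff measurableSet_closedBall]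
    exact ((hγ.integrableOn_isCompact (isCompact_closedBall x ε)).const_mul _)
  have hnorm : ‖((ContinuousLinearMap.mul ℝ ℝ).precompL E) (fderiv ℝ ρ (x - y)) (φ y)‖ ≤
      ‖fderiv ℝ ρ (x - y)‖ * |φ y| := by
    refine ContinuousLinearMap.opNorm_le_bound _ (by positivity) fun v => ?_
    simp only [ContinuousLinearMap.precompL_apply, ContinuousLinearMap.mul_apply', norm_mul,
      Real.norm_eq_abs]
    have := (fderiv ℝ ρ (x - y)).le_opNorm v
    rw [Real.norm_eq_abs] at this
    nlinarith [abs_nonneg (φ y)]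
  refine hnorm.trans ?_
  by_cases hy : y ∈ closedBall x ε
  · rw [indicator_of_mem hy, mul_assoc]
    exact mul_le_mul (hρ.fderiv_bound _) (hle y hy) (abs_nonneg _) hK₁
  · rw [indicator_of_notMem hy]
    have : fderiv ℝ ρ (x - y) = 0 := by
      by_contra h
      have hsub : tsupport ρ ⊆ closedBall 0 ε :=
        closure_minimal (fun w hw => by simpa using hρ.dist_le w hw) isClosed_closedBall
      have := hsub (support_fderiv_subset ℝ (f := ρ) h)
      rw [mem_closedBall_zero_iff, ← dist_eq_norm, dist_comm] at this
      exact hy this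
    simp [this]


lemma abs_integral_le (hρ : IsConvexKernel ρ ε K₀ K₁) (hγ : LocallyIntegrable γ μ) (x : E)
    (hle : ∀ y, |φ y| ≤ γ y) :
    |∫ y, ρ (x - y) * φ y ∂μ| ≤ K₀ * ∫ y in closedBall x ε, γ y ∂μ := by
  rw [← integral_const_mul, ← integral_indicator measurableSet_closedBall, ← Real.norm_eq_abs]
  refine norm_integral_le_of_norm_le ?_ (ae_of_all _ fun y => ?_)
  · rw [integrable_indicator_iff measurableSet_closedBall]
    exact ((hγ.integrableOn_isCompact (isCompact_closedBall x ε)).const_mul _)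
  rw [norm_mul, Real.norm_eq_abs, Real.norm_eq_abs]
  by_cases hy : ρ (x - y) = 0
  · have hK₀ : 0 ≤ K₀ := (abs_nonneg _).trans (hρ.bound 0)
    rw [hy, abs_zero, zero_mul]
    exact indicator_nonneg (fun y _ => mul_nonneg hK₀ ((abs_nonneg _).trans (hle y))) _
  · have : y ∈ closedBall x ε := by
      rw [mem_closedBall, dist_comm, dist_eq_norm]
      exact hρ.dist_le _ hy
    rw [indicator_of_mem this]
    exact mul_le_mul (hρ.bound _) (hle y) (abs_nonneg _) ((abs_nonneg _).trans (hρ.bound 0))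

lemma locallyIntegrable_indicator (hρ : IsConvexKernel ρ ε K₀ K₁) (hγ : LocallyIntegrable γ μ)
    (hle : ∀ y, |φ y| ≤ γ y) : LocallyIntegrable ((convRegion μ ρ φ).indicator φ) μ :=
  hγ.mono hρ.aestronglyMeasurable_indicator (ae_of_all _ fun y =>
    (norm_indicator_le_norm_self _ _).trans ((hle y).trans (le_abs_self _)))

/-- The gradient of the commutator of convolution and multiplication at a given point. No
measurability of `g` is assumed, so that the convolutions may diverge on a large set. -/
theorem norm_fderiv_commutator_le (hρ : IsConvexKernel ρ ε K₀ K₁) (hε : 0 < ε)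
    (hγ : LocallyIntegrable γ μ) {f g : E → ℝ} (hg : ∀ y, |g y| ≤ γ y) {M : ℝ}
    (hM : 0 ≤ M) (hfb : ∀ y, |f y| ≤ M) (hf : LipschitzWith M.toNNReal f) (x : E) :
    ‖fderiv ℝ (fun z => ∫ y, ρ (z - y) * (f y * g y) ∂μ - f z * ∫ y, ρ (z - y) * g y ∂μ) x‖ ≤
      (3 * ε * K₁ + K₀) * M * ∫ y in closedBall x ε, γ y ∂μ := by
  set h : E → ℝ := fun z => ∫ y, ρ (z - y) * (f y * g y) ∂μ - f z * ∫ y, ρ (z - y) * g y ∂μ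
    with hdef
  set I := ∫ y in closedBall x ε, γ y ∂μ with hI
  have hγ0 : ∀ y, 0 ≤ γ y := fun y => (abs_nonneg _).trans (hg y)
  have hI0 : 0 ≤ I := integral_nonneg fun y => hγ0 y
  have hK₀ : 0 ≤ K₀ := (abs_nonneg _).trans (hρ.bound 0)
  have hK₁ : 0 ≤ K₁ := (norm_nonneg _).trans (hρ.fderiv_bound 0)
  have hlip : ∀ y z, |f y - f z| ≤ M * dist y z := fun y z => by
    simpa [Real.dist_eq, hM] using hf.dist_le_mul y z
  have hfm : AEStronglyMeasurable f μ := hf.continuous.aestronglyMeasurable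
  by_cases hd : DifferentiableAt ℝ h x
  swap
  · rw [fderiv_zero_of_not_differentiableAt hd, norm_zero]
    positivity
  have hγM : LocallyIntegrable (fun y => M * γ y) μ := hγ.smul M
  have hfg : ∀ y, |f y * g y| ≤ M * γ y := fun y => by
    rw [abs_mul]
    exact mul_le_mul (hfb y) (hg y) (abs_nonneg _) hM
  have hPQ : convPoints μ ρ g ⊆ convPoints μ ρ (fun y => f y * g y) := fun z hz =>
    hρ.mem_convPoints hγM hfg (hfm.restrict.mul (hρ.aestronglyMeasurable_restrict hz))
  have hundef : ∀ {ψ : E → ℝ} {z}, z ∉ convPoints μ ρ ψ → ∫ y, ρ (z - y) * ψ y ∂μ = 0 :=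
    fun hz => integral_undef hz
  by_cases hxQ : x ∈ closure (convPoints μ ρ fun y => f y * g y)ᶜ
  · obtain ⟨B, hB, hBo, hxB, hBQ⟩ := hρ.exists_convex_of_mem_closure hγM hfg hxQ
    have hzero : EqOn h (fun _ => 0) B := fun z hz => by
      have hzP : z ∉ convPoints μ ρ g := fun hp => hBQ hz (hPQ hp)
      simp only [hdef, hundef hzP, hundef (hBQ hz), mul_zero, sub_zero]
    rw [fderiv_eq_of_eqOn_convex hB hBo hxB hzero hd (differentiableAt_const 0)]
    simp only [fderiv_fun_const, Pi.zero_apply, norm_zero]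
    positivity
  rw [closure_compl, notMem_compl_iff, mem_interior_iff_mem_nhds, Metric.mem_nhds_iff] at hxQ
  obtain ⟨δ, hδ, hδQ⟩ := hxQ
  by_cases hxP : x ∈ closure (convPoints μ ρ g)ᶜ
  · obtain ⟨B, hB, hBo, hxB, hBP⟩ := hρ.exists_convex_of_mem_closure hγ hg hxP
    have hcl : x ∈ closure (ball x δ ∩ B) := isOpen_ball.inter_closure ⟨mem_ball_self hδ, hxB⟩
    have heq : EqOn h (fun z => ∫ y, ρ (z - y) *
        (convRegion μ ρ fun y => f y * g y).indicator (fun y => f y * g y) y ∂μ)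
        (ball x δ ∩ B) := fun z hz => by
      simp only [hdef, hundef (hBP hz.2), mul_zero, sub_zero,
        mul_indicator_convRegion (hδQ hz.1)]
    have hzero : ∃ w, dist x w ≤ 2 * ε ∧ f w = 0 := by
      obtain ⟨z, hzP, hz⟩ := Metric.mem_closure_iff.1 hxP (min δ ε) (lt_min hδ hε)
      by_contra! hne
      refine hzP (hρ.mem_convPoints hγ hg ?_)
      have hzQ : z ∈ convPoints μ ρ (fun y => f y * g y) :=
        hδQ (by rw [mem_ball, dist_comm]; exact hz.trans_le (min_le_left _ _))
      have hinv : AEStronglyMeasurable (fun y => (f y)⁻¹) μ :=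
        hf.continuous.measurable.inv.aestronglyMeasurable
      refine (hinv.restrict.mul (hρ.aestronglyMeasurable_restrict hzQ)).congr ?_
      filter_upwards [ae_restrict_mem (hρ.isOpen_ne z).measurableSet] with y hy
      refine inv_mul_cancel_left₀ (hne y ?_) _
      have h1 := hρ.dist_le _ hy
      have h2 : dist z y ≤ ε := (dist_eq_norm z y).trans_le h1
      linarith [dist_triangle x z y, hz.trans_le (min_le_right _ _)]
    obtain ⟨w, hw, hfw⟩ := hzero
    have hbound := hρ.differentiableAt_and_norm_fderiv_le (A := 3 * ε * M)
      (hρ.locallyIntegrable_indicator hγM hfg) hγ x fun y hy => by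
        refine (norm_indicator_le_norm_self (fun y => f y * g y) y).trans ?_
        rw [norm_mul]
        refine mul_le_mul ?_ (hg y) (norm_nonneg _) (by positivity)
        have h1 := hlip y w
        rw [hfw, sub_zero] at h1
        refine h1.trans ?_
        have h2 : dist y w ≤ 3 * ε := by
          linarith [dist_triangle y x w, mem_closedBall.1 hy]
        nlinarith
    rw [fderiv_eq_of_eqOn_convex ((convex_ball x δ).inter hB) (isOpen_ball.inter hBo) hcl heq hd
      hbound.1]
    refine hbound.2.trans ?_
    have : 0 ≤ K₀ * M * I := by positivity
    linarith
  · rw [closure_compl, notMem_compl_iff, mem_interior_iff_mem_nhds] at hxP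
    set G := (convRegion μ ρ g).indicator g with hG
    have hGi : LocallyIntegrable G μ := hρ.locallyIntegrable_indicator hγ hg
    have hGle : ∀ y, |G y| ≤ γ y := fun y =>
      (norm_indicator_le_norm_self g y).trans (hg y)
    set m : E → ℝ := fun z => ∫ y, ρ (z - y) * G y ∂μ with hm
    set k : E → ℝ := fun z => ∫ y, ρ (z - y) * ((f y - f x) * G y) ∂μ with hk
    have hfGi : LocallyIntegrable (fun y => (f y - f x) * G y) μ := by
      refine (hγ.smul (2 * M)).mono
        ((hfm.sub aestronglyMeasurable_const).mul hGi.aestronglyMeasurable)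
        (ae_of_all _ fun y => ?_)
      rw [norm_mul, Pi.smul_apply, norm_smul]
      refine mul_le_mul ?_ ((hGle y).trans (le_abs_self _)) (norm_nonneg _) (norm_nonneg _)
      refine (abs_sub _ _).trans ?_
      rw [Real.norm_of_nonneg (by positivity)]
      linarith [hfb y, hfb x]
    have hkd := hρ.differentiableAt_and_norm_fderiv_le (A := M * ε) hfGi hγ x fun y hy => by
      rw [abs_mul]
      refine mul_le_mul ?_ (hGle y) (abs_nonneg _) (by positivity)
      exact (hlip y x).trans (mul_le_mul_of_nonneg_left hy hM)
    have hmd := hρ.differentiableAt_and_norm_fderiv_le (A := 1) hGi hγ x fun y _ => by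
      simpa using hGle y
    have hev : h =ᶠ[𝓝 x] fun z => k z - (f z - f x) * m z := by
      filter_upwards [hxP] with z hz
      have h1 : k z = ∫ y, ρ (z - y) * (f y * g y) ∂μ - f x * ∫ y, ρ (z - y) * g y ∂μ := by
        rw [← integral_const_mul, ← integral_sub (hPQ hz) (Integrable.const_mul hz _)]
        refine integral_congr_ae (ae_of_all _ fun y => ?_)
        have := mul_indicator_convRegion hz y
        simp only [hG]
        linear_combination (f y - f x) * this
      have h2 : m z = ∫ y, ρ (z - y) * g y ∂μ :=
        integral_congr_ae (ae_of_all _ fun y => mul_indicator_convRegion hz y)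
      rw [h1, h2]
      simp only [hdef]
      ring
    have hqev : (fun z => (f z - f x) * m z) =ᶠ[𝓝 x] fun z => k z - h z := by
      filter_upwards [hev] with z hz
      rw [hz]
      ring
    have hqd : DifferentiableAt ℝ (fun z => (f z - f x) * m z) x :=
      (hkd.1.sub hd).congr_of_eventuallyEq hqev
    have hqle : ‖fderiv ℝ (fun z => (f z - f x) * m z) x‖ ≤ M * |m x| := by
      refine le_of_forall_pos_le_add fun η hη => ?_
      have hc : ∀ᶠ z in 𝓝 x, M * |m z| < M * |m x| + η :=
        (hmd.1.continuousAt.abs.const_mul M).eventually_lt_const (by simpa [hm] using hη)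
      refine norm_fderiv_le_of_lip' ℝ (by positivity) ?_
      filter_upwards [hc] with z hz
      rw [sub_self, zero_mul, sub_zero, norm_mul, Real.norm_eq_abs, Real.norm_eq_abs]
      have h1 := hlip z x
      rw [dist_eq_norm] at h1
      nlinarith [mul_le_mul_of_nonneg_right h1 (abs_nonneg (m z)),
        mul_le_mul_of_nonneg_right hz.le (norm_nonneg (z - x))]
    rw [hev.fderiv_eq, fderiv_fun_sub hkd.1 hqd]
    refine (norm_sub_le _ _).trans ?_
    have hm0 : |m x| ≤ K₀ * I := hρ.abs_integral_le hγ x hGle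
    have h3 := hkd.2
    have h4 : 0 ≤ ε * K₁ * M * I := by positivity
    have h5 := mul_le_mul_of_nonneg_left hm0 hM
    linarith

end IsConvexKernel

end Kernel
section StdMollifier

lemma stdBump_eq (n : ℕ) (c : ℝ) (x : Fin n → ℝ) :
    stdBump n c x = c * expNegInvGlue (1 - ∑ i, x i ^ 2) := by
  unfold stdBump expNegInvGlue
  by_cases h : ∑ i, x i ^ 2 < 1
  · rw [if_pos h, if_neg (by linarith), ← neg_sub (1 : ℝ), one_div, inv_neg]
  · rw [if_neg h, if_pos (by linarith), mul_zero]

lemma contDiff_stdBump (n : ℕ) (c : ℝ) : ContDiff ℝ 1 (stdBump n c) := by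
  rw [funext (stdBump_eq n c)]
  exact contDiff_const.mul ((expNegInvGlue.contDiff (n := 1)).comp (by fun_prop))

lemma stdBump_ne_zero_iff {n : ℕ} {c : ℝ} (hc : 0 < c) (x : Fin n → ℝ) :
    stdBump n c x ≠ 0 ↔ ∑ i, x i ^ 2 < 1 := by
  rw [stdBump_eq, mul_ne_zero_iff, Ne, Ne, expNegInvGlue.zero_iff_nonpos, not_le, sub_pos]
  exact and_iff_right hc.ne'

lemma norm_le_one_of_stdBump_ne_zero {n : ℕ} {c : ℝ} (hc : 0 < c) {x : Fin n → ℝ}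
    (hx : stdBump n c x ≠ 0) : ‖x‖ ≤ 1 := by
  rw [stdBump_ne_zero_iff hc] at hx
  refine (pi_norm_le_iff_of_nonneg zero_le_one).2 fun i => ?_
  have := Finset.single_le_sum (f := fun i => x i ^ 2) (fun i _ => sq_nonneg _)
    (Finset.mem_univ i)
  exact (sq_le_one_iff_abs_le_one _).1 (this.trans hx.le)

lemma convex_sum_sq_lt_one (n : ℕ) : Convex ℝ {x : Fin n → ℝ | ∑ i, x i ^ 2 < 1} := by
  have h : ConvexOn ℝ univ fun x : Fin n → ℝ => ∑ i, x i ^ 2 := by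
    refine ⟨convex_univ, fun x _ y _ a b ha hb hab => ?_⟩
    simp only [smul_eq_mul, Finset.mul_sum, ← Finset.sum_add_distrib]
    refine Finset.sum_le_sum fun i _ => ?_
    exact (even_two.convexOn_pow (𝕜 := ℝ)).2 (mem_univ (x i)) (mem_univ (y i)) ha hb hab
  simpa using h.convex_lt 1

lemma exists_isConvexKernel_stdMollifier (n : ℕ) {c : ℝ} (hc : 0 < c) :
    ∃ K₀ K₁ : ℝ, 0 ≤ K₀ ∧ 0 ≤ K₁ ∧ ∀ ε : ℝ, 0 < ε →
      IsConvexKernel (stdMollifier n c ε) ε ((ε ^ n)⁻¹ * K₀) ((ε ^ n)⁻¹ * (ε⁻¹ * K₁)) := by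
  have hcd := contDiff_stdBump n c
  have hcs : HasCompactSupport (stdBump n c) :=
    HasCompactSupport.intro (isCompact_closedBall (0 : Fin n → ℝ) 1) fun x hx => by
      by_contra h
      exact hx (by simpa using norm_le_one_of_stdBump_ne_zero hc h)
  obtain ⟨K₀, hK₀⟩ := hcd.continuous.bounded_above_of_compact_support hcs
  obtain ⟨K₁, hK₁⟩ := (hcd.continuous_fderiv one_ne_zero).bounded_above_of_compact_support
    (hcs.fderiv ℝ)
  refine ⟨K₀, K₁, (norm_nonneg _).trans (hK₀ 0), (norm_nonneg _).trans (hK₁ 0), fun ε hε => ?_⟩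
  have heq : stdMollifier n c ε = fun x => (ε ^ n)⁻¹ * stdBump n c (ε⁻¹ • x) := by
    ext x
    rw [stdMollifier, zpow_neg, zpow_natCast]
  have hne : ∀ x, stdMollifier n c ε x ≠ 0 ↔ stdBump n c (ε⁻¹ • x) ≠ 0 := fun x => by
    rw [heq, mul_ne_zero_iff]
    exact and_iff_right (by positivity)
  refine ⟨?_, ?_, fun x hx => ?_, fun x => ?_, fun x => ?_⟩
  · rw [heq]
    exact contDiff_const.mul (hcd.comp (contDiff_const_smul _))
  · simp only [hne, stdBump_ne_zero_iff hc]
    exact (convex_sum_sq_lt_one n).linear_preimage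
      (LinearMap.lsmul ℝ (Fin n → ℝ) ε⁻¹)
  · have h := norm_le_one_of_stdBump_ne_zero hc ((hne x).1 hx)
    rwa [norm_smul, norm_inv, Real.norm_of_nonneg hε.le, inv_mul_le_iff₀ hε, mul_one] at h
  · rw [heq, abs_mul, abs_of_pos (by positivity)]
    exact mul_le_mul_of_nonneg_left (hK₀ _) (by positivity)
  · have hdiff : DifferentiableAt ℝ (fun x => stdBump n c (ε⁻¹ • x)) x :=
      ((hcd.comp (contDiff_const_smul _)).differentiable one_ne_zero) x
    rw [heq, fderiv_const_mul hdiff, fderiv_comp_smul, norm_smul, norm_smul,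
      Real.norm_of_nonneg (by positivity), Real.norm_of_nonneg (by positivity)]
    gcongr
    exact hK₁ _

end StdMollifier

lemma sq_setIntegral_le {α : Type*} [MeasurableSpace α] {μ : Measure α} {s : Set α}
    (hs : μ s ≠ ⊤) {u : α → ℝ} (hu : IntegrableOn u s μ)
    (hu2 : IntegrableOn (fun x => u x ^ 2) s μ) :
    (∫ x in s, u x ∂μ) ^ 2 ≤ μ.real s * ∫ x in s, u x ^ 2 ∂μ := by
  have : IsFiniteMeasure (μ.restrict s) := isFiniteMeasure_restrict.2 hs
  set T := ∫ x in s, u x ∂μ with hT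
  set V := μ.real s with hV
  have h : ∫ x in s, (V * u x - T) ^ 2 ∂μ = V * (V * ∫ x in s, u x ^ 2 ∂μ - T ^ 2) := by
    have h1 : ∀ x, (V * u x - T) ^ 2 = V ^ 2 * u x ^ 2 - 2 * V * T * u x + T ^ 2 :=
      fun x => by ring
    simp_rw [h1]
    have h2 : IntegrableOn (fun x => V ^ 2 * u x ^ 2) s μ := Integrable.const_mul hu2 _
    have h3 : IntegrableOn (fun x => 2 * V * T * u x) s μ := Integrable.const_mul hu _
    have h4 : IntegrableOn (fun x => V ^ 2 * u x ^ 2 - 2 * V * T * u x) s μ := Integrable.sub h2 h3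
    rw [integral_add h4 (integrable_const _), integral_sub h2 h3, integral_const_mul, integral_const_mul,
      integral_const, ← hT, smul_eq_mul, measureReal_restrict_apply_univ, ← hV]
    ring
  have h0 : 0 ≤ ∫ x in s, (V * u x - T) ^ 2 ∂μ := integral_nonneg fun x => sq_nonneg _
  rcases (measureReal_nonneg (μ := μ) (s := s)).eq_or_lt with hV0 | hVpos
  · have hs0 : μ s = 0 := (measureReal_eq_zero_iff hs).1 hV0.symm
    have : T = 0 := by rw [hT, Measure.restrict_eq_zero.2 hs0, integral_zero_measure]
    rw [this, hV, ← hV0]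
    simp
  · rw [h] at h0
    linarith [nonneg_of_mul_nonneg_right h0 hVpos]

lemma integrable_setIntegral_closedBall {E : Type*} [NormedAddCommGroup E] [NormedSpace ℝ E]
    [FiniteDimensional ℝ E] [MeasurableSpace E] [BorelSpace E] {μ : Measure E}
    [μ.IsAddHaarMeasure] {u : E → ℝ} (hu : Integrable u μ) (r : ℝ) :
    Integrable (fun x => ∫ y in closedBall x r, u y ∂μ) μ ∧
      ∫ x, ∫ y in closedBall x r, u y ∂μ ∂μ = μ.real (closedBall 0 r) * ∫ y, u y ∂μ := by
  have hi : Integrable ((closedBall (0 : E) r).indicator fun _ => (1 : ℝ)) μ :=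
    (integrable_indicator_iff measurableSet_closedBall).2
      (integrableOn_const (isCompact_closedBall _ _).measure_lt_top.ne)
  have heq : (fun x => ∫ y in closedBall x r, u y ∂μ) =
      convolution ((closedBall (0 : E) r).indicator fun _ => (1 : ℝ)) u
        (ContinuousLinearMap.mul ℝ ℝ) μ := by
    ext x
    rw [convolution_mul_swap, ← integral_indicator measurableSet_closedBall]
    refine integral_congr_ae (ae_of_all _ fun y => ?_)
    have : y ∈ closedBall x r ↔ x - y ∈ closedBall (0 : E) r := by
      rw [mem_closedBall_zero_iff, mem_closedBall, dist_comm, dist_eq_norm]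
    by_cases hy : y ∈ closedBall x r
    · simp only [indicator_of_mem hy, indicator_of_mem (this.1 hy), one_mul]
    · simp only [indicator_of_notMem hy, indicator_of_notMem (this.not.1 hy), zero_mul]
  rw [heq]
  refine ⟨hi.integrable_convolution _ hu, ?_⟩
  rw [integral_convolution _ hi hu, integral_indicator measurableSet_closedBall]
  simp

end CommutatorEstimate

/-- **Commutator estimate for mollifiers**: for `f ∈ W^{1,∞}(Ω)` (with norm `≤ M`) and
`g ∈ L²(Ω)` with compact support, `‖∇(η_ε ∗ (fg) − f (η_ε ∗ g))‖_{L²(Ω)} ≤ C M ‖g‖_{L²(Ω)}`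
with `C` independent of `ε`, whenever `0 < ε < min{dist(∂Ω, spt f), dist(∂Ω, spt g)}`. -/
theorem mollifier_commutator_estimate (n : ℕ) (c : ℝ) (hc : 0 < c)
    (hcnorm : ∫ x : Fin n → ℝ, stdBump n c x = 1)
    (Ω : Set (Fin n → ℝ)) (hΩ : IsOpen Ω) :
    ∃ C : ℝ, 0 < C ∧
      ∀ (f g : (Fin n → ℝ) → ℝ) (M ε : ℝ), 0 < ε → 0 ≤ M →
        tsupport f ⊆ Ω → tsupport g ⊆ Ω →
        (∀ x, |f x| ≤ M) → LipschitzWith (Real.toNNReal M) f →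
        Integrable (fun x => (g x) ^ 2) →
        (∀ x ∈ tsupport f, ∀ y ∈ frontier Ω, ε < dist x y) →
        (∀ x ∈ tsupport g, ∀ y ∈ frontier Ω, ε < dist x y) →
        Real.sqrt (∫ x in Ω, ∑ i,
            (pdn (fun z => mollify n c ε (fun y => f y * g y) z
              - f z * mollify n c ε g z) i x) ^ 2)
          ≤ C * M * Real.sqrt (∫ x in Ω, (g x) ^ 2) := by
  obtain ⟨K₀, K₁, hK₀, hK₁, hker⟩ := exists_isConvexKernel_stdMollifier n hc
  refine ⟨√n * (3 * K₁ + K₀) * 2 ^ n + 1, by positivity, ?_⟩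
  intro f g M ε hε hM _ hgΩ hfb hf hg2 _ _
  have hgm : AEStronglyMeasurable (fun x => |g x|) volume := by
    simp_rw [← Real.sqrt_sq_eq_abs]
    exact Real.continuous_sqrt.comp_aestronglyMeasurable hg2.aestronglyMeasurable
  have hγ : LocallyIntegrable (fun x => |g x|) volume :=
    ((memLp_two_iff_integrable_sq hgm).2 (by simpa using hg2)).locallyIntegrable (by norm_num)
  set A := (ε ^ n)⁻¹ * (3 * K₁ + K₀) * M with hA
  have hA0 : 0 ≤ A := by positivity
  have hV : ∀ x : Fin n → ℝ, volume.real (Metric.closedBall x ε) = (2 * ε) ^ n := fun x => by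
    rw [measureReal_def, Real.volume_pi_closedBall x hε.le, Fintype.card_fin,
      ENNReal.toReal_ofReal (by positivity)]
  obtain ⟨hSi, hS⟩ := integrable_setIntegral_closedBall hg2 ε
  set S : (Fin n → ℝ) → ℝ := fun x => ∫ y in Metric.closedBall x ε, g y ^ 2 with hSdef
  have hS0 : ∀ x, 0 ≤ S x := fun x => integral_nonneg fun y => sq_nonneg _
  have hpt : ∀ i x, (pdn (fun z => mollify n c ε (fun y => f y * g y) z
      - f z * mollify n c ε g z) i x) ^ 2 ≤ A ^ 2 * (2 * ε) ^ n * S x := by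
    intro i x
    have hD := (hker ε hε).norm_fderiv_commutator_le hε hγ (fun y => le_rfl) hM hfb hf x
    have hsq := sq_setIntegral_le (measure_closedBall_lt_top (x := x) (r := ε)).ne
      (hγ.integrableOn_isCompact (isCompact_closedBall x ε)) (by simpa using hg2.integrableOn)
    simp only [sq_abs, hV] at hsq
    have hfac : (3 * ε * ((ε ^ n)⁻¹ * (ε⁻¹ * K₁)) + (ε ^ n)⁻¹ * K₀) * M = A := by
      rw [hA]
      field_simp
    rw [hfac] at hD
    rw [mul_assoc]
    refine le_trans ?_ (mul_le_mul_of_nonneg_left hsq (sq_nonneg A))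
    rw [← mul_pow, sq_le_sq, abs_of_nonneg (a := A * _)
      (mul_nonneg hA0 (integral_nonneg fun y => abs_nonneg _))]
    refine le_trans ?_ hD
    rw [← Real.norm_eq_abs, pdn]
    refine (ContinuousLinearMap.le_opNorm _ _).trans ?_
    rw [Pi.norm_single, norm_one, mul_one]
    rfl
  have hΩg : ∫ x in Ω, g x ^ 2 = ∫ x, g x ^ 2 :=
    setIntegral_eq_integral_of_forall_compl_eq_zero fun x hx => by
      rw [image_eq_zero_of_notMem_tsupport fun h => hx (hgΩ h)]
      norm_num
  have hmain : ∫ x in Ω, ∑ i, (pdn (fun z => mollify n c ε (fun y => f y * g y) z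
      - f z * mollify n c ε g z) i x) ^ 2 ≤
      (√n * (3 * K₁ + K₀) * 2 ^ n * M) ^ 2 * ∫ x in Ω, g x ^ 2 := by
    calc _ ≤ ∫ x in Ω, n * (A ^ 2 * (2 * ε) ^ n * S x) := by
          refine integral_mono_of_nonneg
            (Filter.Eventually.of_forall fun x => Finset.sum_nonneg fun i _ => sq_nonneg _)
            ((hSi.const_mul _).const_mul _).integrableOn
            (Filter.Eventually.of_forall fun x => ?_)
          refine (Finset.sum_le_sum fun i _ => hpt i x).trans ?_
          simp
      _ ≤ ∫ x, n * (A ^ 2 * (2 * ε) ^ n * S x) := by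
          refine setIntegral_le_integral ((hSi.const_mul _).const_mul _)
            (Filter.Eventually.of_forall fun x => ?_)
          have := hS0 x
          simp only [Pi.zero_apply]
          positivity
      _ = _ := by
          rw [integral_const_mul, integral_const_mul, hS, hV, hΩg, hA, mul_pow (2 : ℝ) ε]
          have hsqrt : (√(n : ℝ)) ^ 2 = n := Real.sq_sqrt (Nat.cast_nonneg n)
          simp only [mul_pow, hsqrt, inv_pow]
          field_simp
  refine (Real.sqrt_le_sqrt hmain).trans ?_
  rw [Real.sqrt_mul (sq_nonneg _), Real.sqrt_sq (by positivity)]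
  gcongr
  linarith
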